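/- For every integer n ≥ 0, the number of lattice paths of length 2n+1 that stay in the strip [0, 3] and end at height 1 equals the Fibonacci number F(2n+1). -/

import Mathlib

/-- The height of a lattice path `s : Fin n → ℤ` after `j` steps:
the sum of the first `j` steps. -/
def pathHeight {n : ℕ} (s : Fin n → ℤ) (j : ℕ) : ℤ :=
  ∑ i ∈ Finset.univ.filter (fun i : Fin n => (i : ℕ) < j), s i

/-- The number of lattice paths of length `n` (steps `±1`) whose height stays in
`[a, b]` at every time `0 ≤ j ≤ n` and whose final height lies in `E`. -/
noncomputable def pathCount (n : ℕ) (a b : ℤ) (E : Set ℤ) : ℕ :=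
  Nat.card {s : Fin n → ℤ //
    (∀ i, s i ∈ ({1, -1} : Set ℤ)) ∧
    (∀ j ≤ n, pathHeight s j ∈ Set.Icc a b) ∧
    pathHeight s n ∈ E}

/-- The lattice paths counted by `pathCount n a b {m}`. -/
def pathSet (n : ℕ) (a b m : ℤ) : Set (Fin n → ℤ) :=
  {s | (∀ i, s i ∈ ({1, -1} : Set ℤ)) ∧
    (∀ j ≤ n, pathHeight s j ∈ Set.Icc a b) ∧
    pathHeight s n ∈ ({m} : Set ℤ)}

theorem pathCount_singleton (n : ℕ) (a b m : ℤ) :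
    pathCount n a b {m} = (pathSet n a b m).ncard := rfl

theorem pathSet_finite (n : ℕ) (a b m : ℤ) : (pathSet n a b m).Finite :=
  (Set.Finite.pi' fun _ : Fin n => Set.toFinite ({1, -1} : Set ℤ)).subset fun _ hs => hs.1

theorem pathHeight_snoc_of_le {n : ℕ} (s : Fin n → ℤ) (x : ℤ) {j : ℕ} (hj : j ≤ n) :
    pathHeight (Fin.snoc s x : Fin (n + 1) → ℤ) j = pathHeight s j := by
  simp [pathHeight, Finset.sum_filter, Fin.sum_univ_castSucc, not_lt.mpr hj]

theorem pathHeight_snoc_succ {n : ℕ} (s : Fin n → ℤ) (x : ℤ) :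
    pathHeight (Fin.snoc s x : Fin (n + 1) → ℤ) (n + 1) = pathHeight s n + x := by
  simp only [pathHeight, Finset.sum_filter, Fin.is_lt, if_true, Fin.sum_univ_castSucc,
    Fin.snoc_castSucc, Fin.snoc_last]

theorem snoc_mem_pathSet {n : ℕ} {a b m : ℤ} (s : Fin n → ℤ) (x : ℤ) :
    (Fin.snoc s x : Fin (n + 1) → ℤ) ∈ pathSet (n + 1) a b m ↔
      (x = 1 ∨ x = -1) ∧ m ∈ Set.Icc a b ∧ s ∈ pathSet n a b (m - x) := by
  have h : (∀ j ≤ n + 1, pathHeight (Fin.snoc s x : Fin (n + 1) → ℤ) j ∈ Set.Icc a b) ↔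
      (∀ j ≤ n, pathHeight s j ∈ Set.Icc a b) ∧ pathHeight s n + x ∈ Set.Icc a b := by
    constructor
    · intro h
      refine ⟨fun j hj => ?_, ?_⟩
      · rw [← pathHeight_snoc_of_le s x hj]
        exact h j (by omega)
      · rw [← pathHeight_snoc_succ]
        exact h _ le_rfl
    · rintro ⟨h, h'⟩ j hj
      rcases Nat.le_succ_iff.mp hj with hj | rfl
      · rw [pathHeight_snoc_of_le s x hj]
        exact h j hj
      · rw [pathHeight_snoc_succ]
        exact h'
  simp only [pathSet, Set.mem_ofPred_eq, h, pathHeight_snoc_succ, Fin.forall_fin_succ',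
    Fin.snoc_castSucc, Fin.snoc_last, Set.mem_singleton_iff, Set.mem_insert_iff, eq_sub_iff_add_eq]
  constructor
  · rintro ⟨⟨h1, h2⟩, ⟨h3, h4⟩, rfl⟩
    exact ⟨h2, h4, h1, h3, rfl⟩
  · rintro ⟨h2, h4, h1, h3, rfl⟩
    exact ⟨⟨h1, h2⟩, ⟨h3, h4⟩, rfl⟩

/-- Paths ending inside the strip are counted according to their last step. -/
theorem pathCount_succ (n : ℕ) {a b m : ℤ} (hm : m ∈ Set.Icc a b) :
    pathCount (n + 1) a b {m} = pathCount n a b {m - 1} + pathCount n a b {m + 1} := by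
  have hinj (x : ℤ) : Function.Injective fun s : Fin n → ℤ => (Fin.snoc s x : Fin (n + 1) → ℤ) :=
    fun s t h => (Fin.snoc_injective2 h).1
  have hunion : pathSet (n + 1) a b m =
      (fun s : Fin n → ℤ => (Fin.snoc s 1 : Fin (n + 1) → ℤ)) '' pathSet n a b (m - 1) ∪
      (fun s : Fin n → ℤ => (Fin.snoc s (-1) : Fin (n + 1) → ℤ)) '' pathSet n a b (m + 1) := by
    ext t
    constructor
    · intro ht
      rw [← Fin.snoc_init_self t, snoc_mem_pathSet] at ht
      obtain ⟨hx, -, hs⟩ := ht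
      rcases hx with hx | hx <;> rw [hx] at hs
      · exact Or.inl ⟨Fin.init t, hs, by simp only [← hx, Fin.snoc_init_self]⟩
      · rw [sub_neg_eq_add] at hs
        exact Or.inr ⟨Fin.init t, hs, by simp only [← hx, Fin.snoc_init_self]⟩
    · rintro (⟨s, hs, rfl⟩ | ⟨s, hs, rfl⟩)
      · exact (snoc_mem_pathSet s 1).mpr ⟨Or.inl rfl, hm, hs⟩
      · exact (snoc_mem_pathSet s (-1)).mpr ⟨Or.inr rfl, hm, by rwa [sub_neg_eq_add]⟩
  simp only [pathCount_singleton]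
  rw [hunion, Set.ncard_union_eq _ ((pathSet_finite ..).image _) ((pathSet_finite ..).image _),
    Set.ncard_image_of_injective _ (hinj 1), Set.ncard_image_of_injective _ (hinj (-1))]
  rw [Set.disjoint_left]
  rintro _ ⟨s, -, rfl⟩ ⟨t, -, h⟩
  have := (Fin.snoc_injective2 h).2
  omega

theorem pathCount_eq_zero (n : ℕ) {a b m : ℤ} (hm : m ∉ Set.Icc a b) :
    pathCount n a b {m} = 0 := by
  rw [pathCount_singleton, Set.ncard_eq_zero (pathSet_finite ..), Set.eq_empty_iff_forall_notMem]
  rintro s ⟨-, h, rfl⟩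
  exact hm (h n le_rfl)

theorem pathCount_zero {a b m : ℤ} (h : (0 : ℤ) ∈ Set.Icc a b) :
    pathCount 0 a b {m} = if m = 0 then 1 else 0 := by
  rw [pathCount_singleton]
  have hs : pathSet 0 a b m = if m = 0 then Set.univ else ∅ := by
    ext s
    split_ifs with hm <;> simp_all [pathSet, pathHeight, eq_comm]
  rw [hs]
  split_ifs <;> simp

theorem pathCount_strip_odd (n : ℕ) :
    pathCount (2 * n + 1) 0 3 {1} = Nat.fib (2 * n + 1) ∧
      pathCount (2 * n + 1) 0 3 {3} = Nat.fib (2 * n) := by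
  have h0 (k : ℕ) : pathCount (k + 1) 0 3 {0} = pathCount k 0 3 {1} := by
    rw [pathCount_succ k (by simp), pathCount_eq_zero k (m := 0 - 1) (by simp)]
    simp
  have h1 (k : ℕ) : pathCount (k + 1) 0 3 {1} = pathCount k 0 3 {0} + pathCount k 0 3 {2} :=
    pathCount_succ k (by simp)
  have h2 (k : ℕ) : pathCount (k + 1) 0 3 {2} = pathCount k 0 3 {1} + pathCount k 0 3 {3} :=
    pathCount_succ k (by simp)
  have h3 (k : ℕ) : pathCount (k + 1) 0 3 {3} = pathCount k 0 3 {2} := by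
    rw [pathCount_succ k (by simp), pathCount_eq_zero k (m := 3 + 1) (by simp)]
    simp
  induction n with
  | zero => simp [h1, h3, pathCount_zero]
  | succ n ih =>
    have f2 : Nat.fib (2 * n + 2) = Nat.fib (2 * n) + Nat.fib (2 * n + 1) := Nat.fib_add_two
    have f3 : Nat.fib (2 * n + 3) = Nat.fib (2 * n + 1) + Nat.fib (2 * n + 2) := Nat.fib_add_two
    rw [show 2 * (n + 1) = 2 * n + 1 + 1 by ring, h1, h3, h0, h2, ih.1, ih.2, f3, f2]
    omega

theorem stmt_12 (n : ℕ) :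
    pathCount (2 * n + 1) 0 3 ({1} : Set ℤ) = Nat.fib (2 * n + 1) :=
  (pathCount_strip_odd n).1
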